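/- The quadratic form of the two-dimensional N-electron atomic potential 𝒱_{2D} = −Z Σᵢ 1/|ϱᵢ| + Σ_{i<j} 1/|ϱᵢ−ϱⱼ| satisfies, for every ε > 0 and ψ ∈ H¹(ℝ^{2N}), |⟨ψ, 𝒱_{2D} ψ⟩| ≤ (Γ(1/4)⁴/(8π²)) √N · max{(N−1)/√2, Z} · (ε ‖∇ψ‖² + ε⁻¹ ‖ψ‖²). -/

import Mathlib

open MeasureTheory Real

/-- The two-dimensional `N`-electron atomic potential
`𝒱_{2D}(x) = -Z Σᵢ 1/|ϱᵢ| + Σ_{i<j} 1/|ϱᵢ - ϱⱼ|`, with `ϱᵢ = (x (i,0), x (i,1)) ∈ ℝ²`. -/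
noncomputable def V2D (N : ℕ) (Z : ℝ) (x : EuclideanSpace ℝ (Fin N × Fin 2)) : ℝ :=
  -Z * ∑ i : Fin N, (Real.sqrt ((x (i, 0)) ^ 2 + (x (i, 1)) ^ 2))⁻¹ +
    ∑ p ∈ Finset.univ.filter (fun p : Fin N × Fin N => p.1 < p.2),
      (Real.sqrt ((x (p.1, 0) - x (p.2, 0)) ^ 2 + (x (p.1, 1) - x (p.2, 1)) ^ 2))⁻¹

theorem const_ge_one : 1 ≤ (Real.Gamma (1 / 4)) ^ 4 / (8 * π ^ 2) := by
  have h1 := Real.Gamma_mul_Gamma_one_sub (1/4)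
  have h2 : Real.sin (π * (1/4)) = √2 / 2 := by
    rw [show π * (1/4) = π / 4 by ring, Real.sin_pi_div_four]
  have h3 : (1:ℝ) - 1/4 = 3/4 := by norm_num
  rw [h2, h3] at h1
  have hp := Real.pi_pos
  have hs2 : (√2)^2 = 2 := Real.sq_sqrt (by norm_num)
  have hs2p : 0 < √2 := by positivity
  have h4 : Real.Gamma (1/4) * Real.Gamma (3/4) = π * √2 := by
    rw [h1]; field_simp; nlinarith
  have hG : 0 < Real.Gamma (3/4) := Real.Gamma_pos_of_pos (by norm_num)
  have hG1 : 0 < Real.Gamma (1/4) := Real.Gamma_pos_of_pos (by norm_num)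
  have hc := Real.convexOn_Gamma.2 (show (1/2:ℝ) ∈ Set.Ioi 0 by norm_num)
    (show (1:ℝ) ∈ Set.Ioi 0 by norm_num) (show (0:ℝ) ≤ 1/2 by norm_num)
    (show (0:ℝ) ≤ 1/2 by norm_num) (by norm_num)
  simp only [smul_eq_mul, Real.Gamma_one] at hc
  rw [Real.Gamma_one_half_eq, show (1/2:ℝ) * (1/2) + 1/2*1 = 3/4 by norm_num] at hc
  have hsp : √π ≤ 9/5 := by
    rw [Real.sqrt_le_left (by norm_num)]; linarith [Real.pi_lt_d2]
  have h5 : Real.Gamma (3/4) ≤ 7/5 := by linarith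
  have h6 : π * √2 ≤ Real.Gamma (1/4) * (7/5) := by
    rw [← h4]; gcongr
  have h7 : 1 * π ^ 2 ≤ Real.Gamma (1/4) ^ 2 := by
    have : (π * √2)^2 ≤ (Real.Gamma (1/4) * (7/5))^2 := by gcongr
    rw [mul_pow, hs2] at this
    nlinarith
  have h8 : (1 * π ^ 2)^2 ≤ (Real.Gamma (1/4) ^ 2)^2 := by gcongr
  rw [le_div_iff₀ (by positivity)]
  have h9 : 3 < π := Real.pi_gt_three
  have h10 : (9:ℝ) ≤ π^2 := by nlinarith
  nlinarith

theorem hasDeriv_aux (α c δ : ℝ) (hδ : 0 < δ) :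
    HasDerivAt (fun t : ℝ => (α + t) / √((α + t) ^ 2 + c ^ 2 + δ))
      (1 / √(α ^ 2 + c ^ 2 + δ) - α ^ 2 / ((α ^ 2 + c ^ 2 + δ) * √(α ^ 2 + c ^ 2 + δ))) 0 := by
  have hs : 0 < α ^ 2 + c ^ 2 + δ := by positivity
  have h1 : HasDerivAt (fun t : ℝ => α + t) 1 0 := (hasDerivAt_id 0).const_add α
  have h2 : HasDerivAt (fun t : ℝ => (α + t) ^ 2 + c ^ 2 + δ) (2 * α) 0 := by
    have := ((h1.pow 2).add_const (c^2)).add_const δ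
    simpa using this
  have h3 := h2.sqrt (by simpa using hs.ne')
  have h4 := h1.div h3 (by simpa using (Real.sqrt_pos.2 hs).ne')
  refine h4.congr_deriv ?_
  simp only [add_zero]
  have hq : √(α ^ 2 + c ^ 2 + δ) ^ 2 = α ^ 2 + c ^ 2 + δ := Real.sq_sqrt hs.le
  have hq0 := Real.sqrt_pos.2 hs
  generalize √(α ^ 2 + c ^ 2 + δ) = q at *
  rw [← hq]
  field_simp

theorem abs_aux (α c δ : ℝ) (hδ : 0 < δ) :
    |1 / √(α ^ 2 + c ^ 2 + δ) - α ^ 2 / ((α ^ 2 + c ^ 2 + δ) * √(α ^ 2 + c ^ 2 + δ))| ≤ 1 / √δ := by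
  have hs : 0 < α ^ 2 + c ^ 2 + δ := by positivity
  have hq0 := Real.sqrt_pos.2 hs
  have h1 : α ^ 2 / ((α ^ 2 + c ^ 2 + δ) * √(α ^ 2 + c ^ 2 + δ)) ≤ 1 / √(α ^ 2 + c ^ 2 + δ) := by
    rw [div_le_div_iff₀ (by positivity) hq0]
    nlinarith [mul_nonneg (add_nonneg (sq_nonneg c) hδ.le) hq0.le]
  have h2 : 0 ≤ α ^ 2 / ((α ^ 2 + c ^ 2 + δ) * √(α ^ 2 + c ^ 2 + δ)) := by positivity
  have h3 : 1 / √(α ^ 2 + c ^ 2 + δ) ≤ 1 / √δ := by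
    apply one_div_le_one_div_of_le (Real.sqrt_pos.2 hδ)
    apply Real.sqrt_le_sqrt; nlinarith [sq_nonneg α, sq_nonneg c]
  rw [abs_le]; constructor <;> linarith

theorem abs_aux2 (α c δ : ℝ) (hδ : 0 < δ) : |α / √(α ^ 2 + c ^ 2 + δ)| ≤ 1 := by
  have hs : 0 < α ^ 2 + c ^ 2 + δ := by positivity
  have hq0 := Real.sqrt_pos.2 hs
  rw [abs_div, abs_of_pos hq0, div_le_one hq0]
  apply Real.abs_le_sqrt; nlinarith [sq_nonneg c]

section
set_option linter.unusedSectionVars false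
variable {E : Type*} [NormedAddCommGroup E] [InnerProductSpace ℝ E] [FiniteDimensional ℝ E]
  [MeasurableSpace E] [BorelSpace E]

/-- derivative of `‖ψ‖²` -/
noncomputable def dphi (ψ : SchwartzMap E ℂ) (x : E) : E →L[ℝ] ℝ :=
  2 • (innerSL ℝ (ψ x)).comp (fderiv ℝ ψ x)

theorem dphi_le (ψ : SchwartzMap E ℂ) (x u : E) :
    |dphi ψ x u| ≤ 2 * (‖ψ x‖ * ‖fderiv ℝ ψ x‖) * ‖u‖ := by
  have h : dphi ψ x u = 2 * inner ℝ (ψ x) (fderiv ℝ ψ x u) := by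
    simp [dphi]; ring
  rw [h, abs_mul, abs_two]
  have h1 := abs_real_inner_le_norm (ψ x) (fderiv ℝ ψ x u)
  have h2 := (fderiv ℝ ψ x).le_opNorm u
  have := mul_le_mul_of_nonneg_left h2 (norm_nonneg (ψ x))
  nlinarith

theorem cont_fderiv (ψ : SchwartzMap E ℂ) : Continuous (fderiv ℝ ψ) :=
  (SchwartzMap.fderivCLM ℝ E ℂ ψ).continuous

theorem int_phi (ψ : SchwartzMap E ℂ) : Integrable (fun x => ‖ψ x‖ ^ 2) :=
  (ψ.memLp 2).integrable_norm_pow (by norm_num)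

theorem int_grad (ψ : SchwartzMap E ℂ) : Integrable (fun x => ‖fderiv ℝ ψ x‖ ^ 2) :=
  MemLp.integrable_norm_pow (f := fderiv ℝ ψ) (p := 2)
    ((SchwartzMap.fderivCLM ℝ E ℂ ψ).memLp 2 volume) (by norm_num)

theorem cont_dphi (ψ : SchwartzMap E ℂ) (u : E) : Continuous (fun x => dphi ψ x u) := by
  have h : (fun x => dphi ψ x u) = fun x => 2 * inner ℝ (ψ x) (fderiv ℝ ψ x u) := by
    ext x; simp [dphi]; ring
  rw [h]
  have := cont_fderiv ψ
  have := ψ.continuous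
  fun_prop

theorem int_dphi (ψ : SchwartzMap E ℂ) (u : E) : Integrable (fun x => dphi ψ x u) := by
  refine (((int_phi ψ).add (int_grad ψ)).mul_const ‖u‖).mono'
    (cont_dphi ψ u).aestronglyMeasurable (ae_of_all _ fun x => ?_)
  rw [Real.norm_eq_abs]
  refine (dphi_le ψ x u).trans ?_
  simp only [Pi.add_apply]
  gcongr
  nlinarith [sq_nonneg (‖ψ x‖ - ‖fderiv ℝ ψ x‖)]

theorem cont_s (a b : E →L[ℝ] ℝ) (δ : ℝ) : Continuous (fun x => √(a x ^ 2 + b x ^ 2 + δ)) := by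
  fun_prop

theorem spos (a b δ : ℝ) (hδ : 0 < δ) : 0 < √(a ^ 2 + b ^ 2 + δ) := by positivity

theorem int_gd (ψ : SchwartzMap E ℂ) (a b : E →L[ℝ] ℝ) (u : E) (δ : ℝ) (hδ : 0 < δ) :
    Integrable (fun x => a x / √(a x ^ 2 + b x ^ 2 + δ) * dphi ψ x u) := by
  refine (int_dphi ψ u).bdd_mul (c := 1) ?_ (ae_of_all _ fun x => ?_)
  · exact (a.continuous.div (cont_s a b δ) fun x => (spos _ _ _ hδ).ne').aestronglyMeasurable
  · exact abs_aux2 _ _ _ hδ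

theorem int_dg (ψ : SchwartzMap E ℂ) (a b : E →L[ℝ] ℝ) (δ : ℝ) (hδ : 0 < δ) :
    Integrable (fun x => (1 / √(a x ^ 2 + b x ^ 2 + δ) -
      a x ^ 2 / ((a x ^ 2 + b x ^ 2 + δ) * √(a x ^ 2 + b x ^ 2 + δ))) * ‖ψ x‖ ^ 2) := by
  refine (int_phi ψ).bdd_mul (c := 1 / √δ) ?_ (ae_of_all _ fun x => ?_)
  · refine Continuous.aestronglyMeasurable ?_
    refine (continuous_const.div (cont_s a b δ) fun x => (spos _ _ _ hδ).ne').sub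
      (Continuous.div (by fun_prop) (by fun_prop) fun x => ?_)
    have := spos (a x) (b x) _ hδ
    positivity
  · exact abs_aux _ _ _ hδ

theorem ibp (ψ : SchwartzMap E ℂ) (a b : E →L[ℝ] ℝ) (v : E) (hav : a v = 1) (hbv : b v = 0)
    (δ : ℝ) (hδ : 0 < δ) :
    ∫ x, a x / √(a x ^ 2 + b x ^ 2 + δ) * dphi ψ x v =
      - ∫ x, (1 / √(a x ^ 2 + b x ^ 2 + δ) -
      a x ^ 2 / ((a x ^ 2 + b x ^ 2 + δ) * √(a x ^ 2 + b x ^ 2 + δ))) * ‖ψ x‖ ^ 2 := by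
  refine integral_bilinear_hasLineDerivAt_right_eq_neg_left_of_integrable
    (B := ContinuousLinearMap.mul ℝ ℝ) (v := v) (f := fun x => a x / √(a x ^ 2 + b x ^ 2 + δ))
    (g := fun x => ‖ψ x‖ ^ 2) (int_dg ψ a b δ hδ) (int_gd ψ a b v δ hδ) ?_ ?_ ?_
  · refine (int_phi ψ).bdd_mul (c := 1) ?_ (ae_of_all _ fun x => ?_)
    · exact (a.continuous.div (cont_s a b δ) fun x => (spos _ _ _ hδ).ne').aestronglyMeasurable
    · exact abs_aux2 _ _ _ hδ
  · intro x _
    have := hasDeriv_aux (a x) (b x) δ hδ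
    simpa [HasLineDerivAt, hav, hbv] using this
  · intro x _
    exact (ψ.differentiableAt.hasFDerivAt.norm_sq).hasLineDerivAt v

theorem tend_aux (A B : ℝ) : Filter.Tendsto
    (fun n : ℕ => √(A ^ 2 + B ^ 2) / (A ^ 2 + B ^ 2 + 1 / ((n:ℝ) + 1))) Filter.atTop
    (nhds (√(A ^ 2 + B ^ 2))⁻¹) := by
  have h0 : 0 ≤ A ^ 2 + B ^ 2 := by positivity
  rcases h0.eq_or_lt with h | h
  · simp [← h]
  · have h1 := (tendsto_one_div_add_atTop_nhds_zero_nat (𝕜 := ℝ)).const_add (A ^ 2 + B ^ 2)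
    rw [add_zero] at h1
    have h2 := (tendsto_const_nhds (x := √(A ^ 2 + B ^ 2))).div h1 h.ne'
    rwa [Real.sqrt_div_self] at h2

theorem low_aux (α c δ : ℝ) (hδ : 0 < δ) : √(α ^ 2 + c ^ 2) / (α ^ 2 + c ^ 2 + δ) ≤
    (1 / √(α ^ 2 + c ^ 2 + δ) - α ^ 2 / ((α ^ 2 + c ^ 2 + δ) * √(α ^ 2 + c ^ 2 + δ))) +
    (1 / √(α ^ 2 + c ^ 2 + δ) - c ^ 2 / ((α ^ 2 + c ^ 2 + δ) * √(α ^ 2 + c ^ 2 + δ))) := by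
  have hs : 0 < α ^ 2 + c ^ 2 + δ := by positivity
  have hq0 := Real.sqrt_pos.2 hs
  have hq : √(α ^ 2 + c ^ 2 + δ) ^ 2 = α ^ 2 + c ^ 2 + δ := Real.sq_sqrt hs.le
  have h1 : √(α ^ 2 + c ^ 2) ≤ √(α ^ 2 + c ^ 2 + δ) := Real.sqrt_le_sqrt (by linarith)
  have e : √(α ^ 2 + c ^ 2 + δ) / (α ^ 2 + c ^ 2 + δ) = 1 / √(α ^ 2 + c ^ 2 + δ) := by
    rw [div_eq_div_iff hs.ne' hq0.ne']; nlinarith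
  have h2 : √(α ^ 2 + c ^ 2) / (α ^ 2 + c ^ 2 + δ) ≤ 1 / √(α ^ 2 + c ^ 2 + δ) := by
    rw [← e]; gcongr
  have h3 : α ^ 2 / ((α ^ 2 + c ^ 2 + δ) * √(α ^ 2 + c ^ 2 + δ)) +
    c ^ 2 / ((α ^ 2 + c ^ 2 + δ) * √(α ^ 2 + c ^ 2 + δ)) ≤ 1 / √(α ^ 2 + c ^ 2 + δ) := by
    rw [← add_div, div_le_div_iff₀ (by positivity) hq0]
    nlinarith [mul_nonneg hδ.le hq0.le]
  linarith

/-- the regularised bound -/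
theorem reg_bound {κ : Type*} (P : Finset κ) (a b : κ → E →L[ℝ] ℝ) (v w : κ → E)
    (hav : ∀ p ∈ P, a p (v p) = 1) (hbv : ∀ p ∈ P, b p (v p) = 0)
    (haw : ∀ p ∈ P, a p (w p) = 0) (hbw : ∀ p ∈ P, b p (w p) = 1) (ψ : SchwartzMap E ℂ)
    (δ : ℝ) (hδ : 0 < δ) (M : ℝ) (ε : ℝ) (hε : 0 < ε)
    (hM : ∀ x, ‖∑ p ∈ P, ((a p x / √(a p x ^ 2 + b p x ^ 2 + δ)) • v p +
      (b p x / √(a p x ^ 2 + b p x ^ 2 + δ)) • w p)‖ ≤ M) :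
    Integrable (fun x => (∑ p ∈ P, √(a p x ^ 2 + b p x ^ 2) / (a p x ^ 2 + b p x ^ 2 + δ))
      * ‖ψ x‖ ^ 2) ∧
    ∫ x, (∑ p ∈ P, √(a p x ^ 2 + b p x ^ 2) / (a p x ^ 2 + b p x ^ 2 + δ)) * ‖ψ x‖ ^ 2 ≤
      M * (ε * (∫ x, ‖fderiv ℝ ψ x‖ ^ 2) + ε⁻¹ * ∫ x, ‖ψ x‖ ^ 2) := by
  have hM0 : 0 ≤ M := (norm_nonneg _).trans (hM 0)
  set D : κ → E → ℝ := fun p x =>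
    (1 / √(a p x ^ 2 + b p x ^ 2 + δ) - a p x ^ 2 / ((a p x ^ 2 + b p x ^ 2 + δ) *
      √(a p x ^ 2 + b p x ^ 2 + δ))) * ‖ψ x‖ ^ 2 +
    (1 / √(b p x ^ 2 + a p x ^ 2 + δ) - b p x ^ 2 / ((b p x ^ 2 + a p x ^ 2 + δ) *
      √(b p x ^ 2 + a p x ^ 2 + δ))) * ‖ψ x‖ ^ 2 with hD
  set H : κ → E → ℝ := fun p x =>
    a p x / √(a p x ^ 2 + b p x ^ 2 + δ) * dphi ψ x (v p) +
    b p x / √(b p x ^ 2 + a p x ^ 2 + δ) * dphi ψ x (w p) with hH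
  have iD : ∀ p, Integrable (D p) := fun p =>
    (int_dg ψ (a p) (b p) δ hδ).add (int_dg ψ (b p) (a p) δ hδ)
  have iH : ∀ p, Integrable (H p) := fun p =>
    (int_gd ψ (a p) (b p) (v p) δ hδ).add (int_gd ψ (b p) (a p) (w p) δ hδ)
  have hDH : ∀ p ∈ P, ∫ x, D p x = - ∫ x, H p x := by
    intro p hp
    simp only [hD, hH]
    rw [integral_add (int_dg ψ (a p) (b p) δ hδ) (int_dg ψ (b p) (a p) δ hδ),
      integral_add (int_gd ψ (a p) (b p) (v p) δ hδ) (int_gd ψ (b p) (a p) (w p) δ hδ),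
      ibp ψ (a p) (b p) (v p) (hav p hp) (hbv p hp) δ hδ, ibp ψ (b p) (a p) (w p) (hbw p hp) (haw p hp) δ hδ]
    ring
  have hle : ∀ x, (∑ p ∈ P, √(a p x ^ 2 + b p x ^ 2) / (a p x ^ 2 + b p x ^ 2 + δ)) * ‖ψ x‖ ^ 2
      ≤ ∑ p ∈ P, D p x := by
    intro x
    rw [Finset.sum_mul]
    refine Finset.sum_le_sum fun p _ => ?_
    simp only [hD]
    rw [← add_mul, add_comm (b p x ^ 2)]
    exact mul_le_mul_of_nonneg_right (low_aux _ _ _ hδ) (by positivity)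
  have iS : Integrable (fun x => ∑ p ∈ P, D p x) := integrable_finsetSum _ fun p _ => iD p
  have iL : Integrable (fun x => (∑ p ∈ P, √(a p x ^ 2 + b p x ^ 2) /
      (a p x ^ 2 + b p x ^ 2 + δ)) * ‖ψ x‖ ^ 2) := by
    refine iS.mono' ?_ (ae_of_all _ fun x => ?_)
    · refine Continuous.aestronglyMeasurable ?_
      refine Continuous.mul (continuous_finsetSum _ fun p _ => ?_) (ψ.continuous.norm.pow 2)
      exact Continuous.div (by fun_prop) (by fun_prop) fun x => by positivity
    · rw [Real.norm_eq_abs, abs_of_nonneg (by positivity)]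
      exact hle x
  refine ⟨iL, (integral_mono iL iS hle).trans ?_⟩
  have iHS : Integrable (fun x => ∑ p ∈ P, H p x) := integrable_finsetSum _ fun p _ => iH p
  have e1 : ∫ x, ∑ p ∈ P, D p x = ∫ x, - ∑ p ∈ P, H p x := by
    rw [integral_finsetSum _ fun p _ => iD p, integral_neg, integral_finsetSum _ fun p _ => iH p,
      ← Finset.sum_neg_distrib]
    exact Finset.sum_congr rfl fun p hp => hDH p hp
  have e2 : M * (ε * (∫ x, ‖fderiv ℝ ψ x‖ ^ 2) + ε⁻¹ * ∫ x, ‖ψ x‖ ^ 2) =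
      ∫ x, M * (ε * ‖fderiv ℝ ψ x‖ ^ 2 + ε⁻¹ * ‖ψ x‖ ^ 2) := by
    rw [integral_const_mul, integral_add ((int_grad ψ).const_mul _) ((int_phi ψ).const_mul _),
      integral_const_mul, integral_const_mul]
  rw [e1, e2]
  refine integral_mono iHS.neg
    ((((int_grad ψ).const_mul ε).add ((int_phi ψ).const_mul ε⁻¹)).const_mul M) fun x => ?_
  have e3 : ∑ p ∈ P, H p x = dphi ψ x (∑ p ∈ P, ((a p x / √(a p x ^ 2 + b p x ^ 2 + δ)) • v p +
      (b p x / √(a p x ^ 2 + b p x ^ 2 + δ)) • w p)) := by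
    rw [map_sum]
    refine Finset.sum_congr rfl fun p _ => ?_
    simp only [hH, map_add, map_smul, smul_eq_mul]
    rw [add_comm (b p x ^ 2)]
  simp only [e3]
  refine (neg_le_abs _).trans ((dphi_le ψ x _).trans ?_)
  rw [mul_comm M]
  have h5 : 2 * (‖ψ x‖ * ‖fderiv ℝ ψ x‖) ≤ ε * ‖fderiv ℝ ψ x‖ ^ 2 + ε⁻¹ * ‖ψ x‖ ^ 2 := by
    have : 0 ≤ ε⁻¹ * (ε * ‖fderiv ℝ ψ x‖ - ‖ψ x‖) ^ 2 := by positivity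
    have e : ε⁻¹ * (ε * ‖fderiv ℝ ψ x‖ - ‖ψ x‖) ^ 2 =
      ε * ‖fderiv ℝ ψ x‖ ^ 2 + ε⁻¹ * ‖ψ x‖ ^ 2 - 2 * (‖ψ x‖ * ‖fderiv ℝ ψ x‖) := by
      field_simp; ring
    linarith
  exact mul_le_mul h5 (hM x) (norm_nonneg _) (by positivity)

theorem full_bound {κ : Type*} (P : Finset κ) (a b : κ → E →L[ℝ] ℝ) (v w : κ → E)
    (hav : ∀ p ∈ P, a p (v p) = 1) (hbv : ∀ p ∈ P, b p (v p) = 0)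
    (haw : ∀ p ∈ P, a p (w p) = 0) (hbw : ∀ p ∈ P, b p (w p) = 1) (ψ : SchwartzMap E ℂ)
    (M : ℝ) (ε : ℝ) (hε : 0 < ε)
    (hM : ∀ δ : ℝ, 0 < δ → ∀ x, ‖∑ p ∈ P, ((a p x / √(a p x ^ 2 + b p x ^ 2 + δ)) • v p +
      (b p x / √(a p x ^ 2 + b p x ^ 2 + δ)) • w p)‖ ≤ M) :
    Integrable (fun x => (∑ p ∈ P, (√(a p x ^ 2 + b p x ^ 2))⁻¹) * ‖ψ x‖ ^ 2) ∧
    ∫ x, (∑ p ∈ P, (√(a p x ^ 2 + b p x ^ 2))⁻¹) * ‖ψ x‖ ^ 2 ≤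
      M * (ε * (∫ x, ‖fderiv ℝ ψ x‖ ^ 2) + ε⁻¹ * ∫ x, ‖ψ x‖ ^ 2) := by
  have hM0 : 0 ≤ M := (norm_nonneg _).trans (hM 1 one_pos 0)
  set R := M * (ε * (∫ x, ‖fderiv ℝ ψ x‖ ^ 2) + ε⁻¹ * ∫ x, ‖ψ x‖ ^ 2) with hR
  have hR0 : 0 ≤ R := by
    have h1 : 0 ≤ ∫ x, ‖fderiv ℝ ψ x‖ ^ 2 := integral_nonneg fun x => by positivity
    have h2 : 0 ≤ ∫ x, ‖ψ x‖ ^ 2 := integral_nonneg fun x => by positivity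
    positivity
  set f : E → ℝ := fun x => (∑ p ∈ P, (√(a p x ^ 2 + b p x ^ 2))⁻¹) * ‖ψ x‖ ^ 2 with hf
  set g : ℕ → E → ℝ := fun n x => (∑ p ∈ P, √(a p x ^ 2 + b p x ^ 2) /
    (a p x ^ 2 + b p x ^ 2 + 1 / ((n:ℝ) + 1))) * ‖ψ x‖ ^ 2 with hg
  have hgb : ∀ n, Integrable (g n) ∧ ∫ x, g n x ≤ R := fun n =>
    reg_bound P a b v w hav hbv haw hbw ψ (1 / ((n:ℝ) + 1)) (by positivity) M ε hε
      (hM _ (by positivity))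
  have hf0 : ∀ x, 0 ≤ f x := fun x => by simp only [hf]; positivity
  have hg0 : ∀ n x, 0 ≤ g n x := fun n x => by simp only [hg]; positivity
  have hlim : ∀ x, Filter.Tendsto (fun n => g n x) Filter.atTop (nhds (f x)) := fun x =>
    (tendsto_finsetSum _ fun p _ => tend_aux _ _).mul_const _
  have hmeas : AEStronglyMeasurable f := 
    aestronglyMeasurable_of_tendsto_ae Filter.atTop (fun n => (hgb n).1.aestronglyMeasurable)
      (ae_of_all _ hlim)
  have hlin : ∫⁻ x, ENNReal.ofReal (f x) ≤ ENNReal.ofReal R := by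
    have e : ∀ x, ENNReal.ofReal (f x) =
        Filter.liminf (fun n => ENNReal.ofReal (g n x)) Filter.atTop := fun x =>
      ((ENNReal.continuous_ofReal.tendsto _).comp (hlim x)).liminf_eq.symm
    simp_rw [e]
    refine (lintegral_liminf_le' fun n =>
      (hgb n).1.aestronglyMeasurable.aemeasurable.ennreal_ofReal).trans ?_
    refine Filter.liminf_le_of_le (by isBoundedDefault) fun c hc => ?_
    obtain ⟨n, hn⟩ := hc.exists
    refine hn.trans ?_
    rw [← ofReal_integral_eq_lintegral_ofReal (hgb n).1 (ae_of_all _ (hg0 n))]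
    exact ENNReal.ofReal_le_ofReal (hgb n).2
  have hfi : Integrable f := by
    refine ⟨hmeas, ?_⟩
    rw [hasFiniteIntegral_iff_ofReal (ae_of_all _ hf0)]
    exact hlin.trans_lt ENNReal.ofReal_lt_top
  refine ⟨hfi, ?_⟩
  rw [← ofReal_integral_eq_lintegral_ofReal hfi (ae_of_all _ hf0)] at hlin
  exact (ENNReal.ofReal_le_ofReal_iff hR0).1 hlin
end

theorem norm_field {N : ℕ} {κ : Type*} (P : Finset κ) (σ : κ → Fin N) (α β : κ → ℝ)
    (h : ∀ p, α p ^ 2 + β p ^ 2 ≤ 1) (m : ℝ) (hm : 0 ≤ m)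
    (hc : ∀ i, ((P.filter (fun p => σ p = i)).card : ℝ) ≤ m) :
    ‖∑ p ∈ P, (α p • (EuclideanSpace.single (σ p, (0 : Fin 2)) (1:ℝ) :
        EuclideanSpace ℝ (Fin N × Fin 2)) +
      β p • EuclideanSpace.single (σ p, (1 : Fin 2)) (1:ℝ))‖ ≤ √N * m := by
  have hsq : ∀ (γ : κ → ℝ) (i : Fin N), (∑ p ∈ P.filter (fun p => σ p = i), γ p) ^ 2 ≤
      m * ∑ p ∈ P.filter (fun p => σ p = i), γ p ^ 2 := fun γ i =>
    sq_sum_le_card_mul_sum_sq.trans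
      (mul_le_mul_of_nonneg_right (hc i) (Finset.sum_nonneg fun p _ => sq_nonneg _))
  have key : ‖∑ p ∈ P, (α p • (EuclideanSpace.single (σ p, (0 : Fin 2)) (1:ℝ) :
        EuclideanSpace ℝ (Fin N × Fin 2)) +
      β p • EuclideanSpace.single (σ p, (1 : Fin 2)) (1:ℝ))‖ ^ 2 ≤ (√N * m) ^ 2 := by
    rw [EuclideanSpace.real_norm_sq_eq, Fintype.sum_prod_type]
    have e : (√N * m) ^ 2 = ∑ _i : Fin N, m * m := by
      rw [mul_pow, Real.sq_sqrt (by positivity)]; simp only [Finset.sum_const, Finset.card_univ, Fintype.card_fin, nsmul_eq_mul]; ring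
    rw [e]
    refine Finset.sum_le_sum fun i _ => ?_
    rw [Fin.sum_univ_two]
    have c0 : (∑ p ∈ P, (α p • (EuclideanSpace.single (σ p, (0 : Fin 2)) (1:ℝ) :
        EuclideanSpace ℝ (Fin N × Fin 2)) +
      β p • EuclideanSpace.single (σ p, (1 : Fin 2)) (1:ℝ))) (i, 0) =
        ∑ p ∈ P.filter (fun p => σ p = i), α p := by
      simp [Finset.sum_filter, Pi.single_apply, eq_comm]
    have c1 : (∑ p ∈ P, (α p • (EuclideanSpace.single (σ p, (0 : Fin 2)) (1:ℝ) :
        EuclideanSpace ℝ (Fin N × Fin 2)) +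
      β p • EuclideanSpace.single (σ p, (1 : Fin 2)) (1:ℝ))) (i, 1) =
        ∑ p ∈ P.filter (fun p => σ p = i), β p := by
      simp [Finset.sum_filter, Pi.single_apply, eq_comm]
    rw [c0, c1]
    refine (add_le_add (hsq α i) (hsq β i)).trans ?_
    rw [← mul_add, ← Finset.sum_add_distrib]
    refine mul_le_mul_of_nonneg_left ?_ hm
    refine (Finset.sum_le_sum fun p _ => h p).trans ?_
    simpa using hc i
  exact (sq_le_sq₀ (norm_nonneg _) (by positivity)).1 key

theorem coef_le (A B δ : ℝ) (hδ : 0 < δ) :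
    (A / √(A ^ 2 + B ^ 2 + δ)) ^ 2 + (B / √(A ^ 2 + B ^ 2 + δ)) ^ 2 ≤ 1 := by
  have hs : 0 < A ^ 2 + B ^ 2 + δ := by positivity
  rw [div_pow, div_pow, Real.sq_sqrt hs.le, ← add_div, div_le_one hs]
  linarith

theorem attraction (N : ℕ) (ψ : SchwartzMap (EuclideanSpace ℝ (Fin N × Fin 2)) ℂ)
    (ε : ℝ) (hε : 0 < ε) :
    Integrable (fun x : EuclideanSpace ℝ (Fin N × Fin 2) =>
      (∑ i : Fin N, (√((x (i, 0)) ^ 2 + (x (i, 1)) ^ 2))⁻¹) * ‖ψ x‖ ^ 2) ∧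
    ∫ x : EuclideanSpace ℝ (Fin N × Fin 2),
      (∑ i : Fin N, (√((x (i, 0)) ^ 2 + (x (i, 1)) ^ 2))⁻¹) * ‖ψ x‖ ^ 2 ≤
      √N * 1 * (ε * (∫ x, ‖fderiv ℝ ψ x‖ ^ 2) + ε⁻¹ * ∫ x, ‖ψ x‖ ^ 2) := by
  refine full_bound (Finset.univ : Finset (Fin N))
    (fun i => EuclideanSpace.proj (i, (0 : Fin 2))) (fun i => EuclideanSpace.proj (i, (1 : Fin 2)))
    (fun i => EuclideanSpace.single (i, (0 : Fin 2)) 1)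
    (fun i => EuclideanSpace.single (i, (1 : Fin 2)) 1)
    (by simp) (by simp) (by simp) (by simp) ψ _ ε hε fun δ hδ x => ?_
  refine norm_field Finset.univ (fun i => i) _ _ (fun p => coef_le _ _ _ hδ) 1 zero_le_one ?_
  intro i
  simp [Finset.filter_eq']

/-- the difference functional `x ↦ x k - x l` -/
noncomputable def dfun {ι : Type*} [Fintype ι] (k l : ι) : EuclideanSpace ℝ ι →L[ℝ] ℝ :=
  EuclideanSpace.proj k - EuclideanSpace.proj l

theorem dfun_apply {ι : Type*} [Fintype ι] (k l : ι) (x : EuclideanSpace ℝ ι) :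
    dfun k l x = x k - x l := by
  simp [dfun]

theorem card_aux (N : ℕ) (hN : 1 ≤ N) (i : Fin N) :
    (((Finset.univ.filter (fun p : Fin N × Fin N => p.1 ≠ p.2)).filter
      (fun p => p.1 = i)).card : ℝ) ≤ (N : ℝ) - 1 := by
  have hsub : (Finset.univ.filter (fun p : Fin N × Fin N => p.1 ≠ p.2)).filter (fun p => p.1 = i) ⊆
      (Finset.univ.erase i).image (fun j => (i, j)) := by
    rintro ⟨j, k⟩ hp
    simp only [Finset.mem_filter, Finset.mem_univ, true_and] at hp
    obtain ⟨h1, rfl⟩ := hp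
    simp [Ne.symm h1]
  have h1 := (Finset.card_le_card hsub).trans Finset.card_image_le
  rw [Finset.card_erase_of_mem (Finset.mem_univ i), Finset.card_univ, Fintype.card_fin] at h1
  have h2 : ((N - 1 : ℕ) : ℝ) = N - 1 := by push_cast [hN]; ring
  rw [← h2]
  exact_mod_cast h1

theorem repulsion (N : ℕ) (hN : 1 ≤ N) (ψ : SchwartzMap (EuclideanSpace ℝ (Fin N × Fin 2)) ℂ)
    (ε : ℝ) (hε : 0 < ε) :
    Integrable (fun x : EuclideanSpace ℝ (Fin N × Fin 2) =>
      (∑ p ∈ Finset.univ.filter (fun p : Fin N × Fin N => p.1 ≠ p.2),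
      (√((x (p.1, 0) - x (p.2, 0)) ^ 2 + (x (p.1, 1) - x (p.2, 1)) ^ 2))⁻¹) * ‖ψ x‖ ^ 2) ∧
    ∫ x : EuclideanSpace ℝ (Fin N × Fin 2),
      (∑ p ∈ Finset.univ.filter (fun p : Fin N × Fin N => p.1 ≠ p.2),
      (√((x (p.1, 0) - x (p.2, 0)) ^ 2 + (x (p.1, 1) - x (p.2, 1)) ^ 2))⁻¹) * ‖ψ x‖ ^ 2 ≤
      √N * (N - 1) * (ε * (∫ x, ‖fderiv ℝ ψ x‖ ^ 2) + ε⁻¹ * ∫ x, ‖ψ x‖ ^ 2) := by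
  have hN' : (1:ℝ) ≤ N := by exact_mod_cast hN
  have key := full_bound (Finset.univ.filter (fun p : Fin N × Fin N => p.1 ≠ p.2))
    (fun p => dfun (p.1, (0 : Fin 2)) (p.2, (0 : Fin 2)))
    (fun p => dfun (p.1, (1 : Fin 2)) (p.2, (1 : Fin 2)))
    (fun p => EuclideanSpace.single (p.1, (0 : Fin 2)) 1)
    (fun p => EuclideanSpace.single (p.1, (1 : Fin 2)) 1)
    (fun p hp => by
      have := (Finset.mem_filter.1 hp).2
      rw [dfun_apply]; simp [Ne.symm this])
    (fun p hp => by rw [dfun_apply]; simp)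
    (fun p hp => by rw [dfun_apply]; simp)
    (fun p hp => by
      have := (Finset.mem_filter.1 hp).2
      rw [dfun_apply]; simp [Ne.symm this])
    ψ (√N * (N - 1)) ε hε
    (fun δ hδ x => norm_field (Finset.univ.filter (fun p : Fin N × Fin N => p.1 ≠ p.2))
      (fun p => p.1) _ _ (fun p => coef_le _ _ _ hδ) _ (by linarith) (card_aux N hN))
  simp only [dfun_apply] at key
  exact key

theorem sum_half {N : ℕ} (f : Fin N × Fin N → ℝ) (hf : ∀ p, f p.swap = f p) :
    ∑ p ∈ Finset.univ.filter (fun p : Fin N × Fin N => p.1 < p.2), f p =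
    1 / 2 * ∑ p ∈ Finset.univ.filter (fun p : Fin N × Fin N => p.1 ≠ p.2), f p := by
  have h1 : ∑ p ∈ Finset.univ.filter (fun p : Fin N × Fin N => p.2 < p.1), f p =
      ∑ p ∈ Finset.univ.filter (fun p : Fin N × Fin N => p.1 < p.2), f p :=
    Finset.sum_equiv (Equiv.prodComm _ _) (by simp) (fun p _ => (hf p).symm)
  have h2 : ∑ p ∈ Finset.univ.filter (fun p : Fin N × Fin N => p.1 ≠ p.2), f p =
      ∑ p ∈ Finset.univ.filter (fun p : Fin N × Fin N => p.1 < p.2), f p +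
      ∑ p ∈ Finset.univ.filter (fun p : Fin N × Fin N => p.2 < p.1), f p := by
    simp only [Finset.sum_filter]
    rw [← Finset.sum_add_distrib]
    refine Finset.sum_congr rfl fun p _ => ?_
    rcases lt_trichotomy p.1 p.2 with h | h | h
    · simp [h, h.ne, h.le]
    · simp [h]
    · simp [h, h.ne', h.le]
  rw [h2, h1]; ring

/-- Form bound on the two-dimensional atomic potential: for every `ε > 0` and
`ψ ∈ H¹(ℝ^{2N})` (here Schwartz),
`|⟨ψ, 𝒱_{2D} ψ⟩| ≤ (Γ(1/4)⁴/(8π²)) √N max{(N-1)/√2, Z} (ε ‖∇ψ‖² + ε⁻¹ ‖ψ‖²)`. -/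
theorem V2D_form_bound (N : ℕ) (Z : ℝ) (hZ : 0 < Z)
    (ψ : SchwartzMap (EuclideanSpace ℝ (Fin N × Fin 2)) ℂ) (ε : ℝ) (hε : 0 < ε) :
    |∫ x : EuclideanSpace ℝ (Fin N × Fin 2), V2D N Z x * ‖ψ x‖ ^ 2| ≤
      (Real.Gamma (1 / 4)) ^ 4 / (8 * π ^ 2) * Real.sqrt N *
        max (((N : ℝ) - 1) / Real.sqrt 2) Z *
        (ε * (∫ x : EuclideanSpace ℝ (Fin N × Fin 2), ‖fderiv ℝ (⇑ψ) x‖ ^ 2) +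
          ε⁻¹ * ∫ x : EuclideanSpace ℝ (Fin N × Fin 2), ‖ψ x‖ ^ 2) := by
  have hC := const_ge_one
  set C := (Real.Gamma (1 / 4)) ^ 4 / (8 * π ^ 2) with hCdef
  set T := ε * (∫ x : EuclideanSpace ℝ (Fin N × Fin 2), ‖fderiv ℝ (⇑ψ) x‖ ^ 2) +
          ε⁻¹ * ∫ x : EuclideanSpace ℝ (Fin N × Fin 2), ‖ψ x‖ ^ 2 with hT
  have hT0 : 0 ≤ T := by
    have h1 : 0 ≤ ∫ x, ‖fderiv ℝ ψ x‖ ^ 2 := integral_nonneg fun x => by positivity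
    have h2 : 0 ≤ ∫ x, ‖ψ x‖ ^ 2 := integral_nonneg fun x => by positivity
    positivity
  rcases Nat.eq_zero_or_pos N with h0 | hN
  · subst h0
    simp [V2D]
  have hN' : (1:ℝ) ≤ N := by exact_mod_cast hN
  obtain ⟨iA, bA⟩ := attraction N ψ ε hε
  obtain ⟨iB, bB⟩ := repulsion N hN ψ ε hε
  rw [← hT] at bA bB
  have e : ∀ x, V2D N Z x * ‖ψ x‖ ^ 2 =
      -Z * ((∑ i : Fin N, (√((x (i, 0)) ^ 2 + (x (i, 1)) ^ 2))⁻¹) * ‖ψ x‖ ^ 2) +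
      1 / 2 * ((∑ p ∈ Finset.univ.filter (fun p : Fin N × Fin N => p.1 ≠ p.2),
      (√((x (p.1, 0) - x (p.2, 0)) ^ 2 + (x (p.1, 1) - x (p.2, 1)) ^ 2))⁻¹) * ‖ψ x‖ ^ 2) := by
    intro x
    rw [V2D, sum_half (fun p : Fin N × Fin N =>
      (√((x (p.1, 0) - x (p.2, 0)) ^ 2 + (x (p.1, 1) - x (p.2, 1)) ^ 2))⁻¹)]
    · ring
    · intro p
      simp only [Prod.fst_swap, Prod.snd_swap]
      congr 2; ring
  simp_rw [e]
  rw [integral_add (iA.const_mul _) (iB.const_mul _), integral_const_mul, integral_const_mul]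
  set IA := ∫ x : EuclideanSpace ℝ (Fin N × Fin 2),
      (∑ i : Fin N, (√((x (i, 0)) ^ 2 + (x (i, 1)) ^ 2))⁻¹) * ‖ψ x‖ ^ 2 with hIA
  set IB := ∫ x : EuclideanSpace ℝ (Fin N × Fin 2),
      (∑ p ∈ Finset.univ.filter (fun p : Fin N × Fin N => p.1 ≠ p.2),
      (√((x (p.1, 0) - x (p.2, 0)) ^ 2 + (x (p.1, 1) - x (p.2, 1)) ^ 2))⁻¹) * ‖ψ x‖ ^ 2 with hIB
  have hA0 : 0 ≤ IA := integral_nonneg fun x => by positivity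
  have hB0 : 0 ≤ IB := integral_nonneg fun x => by positivity
  set m := max (((N : ℝ) - 1) / Real.sqrt 2) Z with hm
  have hm0 : 0 ≤ m := hZ.le.trans (le_max_right _ _)
  have hS : 0 ≤ √(N:ℝ) * m * T := by positivity
  have hfin : √(N:ℝ) * m * T ≤ C * √(N:ℝ) * m * T := by nlinarith
  have hA : Z * IA ≤ √(N:ℝ) * m * T := by
    calc Z * IA ≤ Z * (√N * 1 * T) := by gcongr
      _ = √N * Z * T := by ring
      _ ≤ √N * m * T := by gcongr; exact le_max_right _ _
  have hs2 : √2 ≤ 2 := by rw [Real.sqrt_le_left (by norm_num)]; norm_num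
  have hB : 1 / 2 * IB ≤ √(N:ℝ) * m * T := by
    calc 1 / 2 * IB ≤ 1 / 2 * (√N * (N - 1) * T) := by gcongr
      _ = √N * ((N - 1) / 2) * T := by ring
      _ ≤ √N * (((N : ℝ) - 1) / Real.sqrt 2) * T := by
        gcongr
      _ ≤ √N * m * T := by gcongr; exact le_max_left _ _
  have hZA : 0 ≤ Z * IA := by positivity
  rw [abs_le]
  constructor <;> linarith
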